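/- arXiv:1908.10215 — 3 statements merged into one kernel-verified Lean document; each statement's English description precedes it below -/
import Mathlib

section
/- For all positive integers m and n, the Ramsey number satisfies R(m,n) ≤ C(m+n, n), where C(m+n,n) denotes the binomial coefficient. -/
/-- An edge coloring of the complete graph on `Fin n`: each 2-element subset of
vertices (edge) is colored with one of two colors (`true` = red, `false` = blue). -/
abbrev EdgeColoring (n : ℕ) : Type := {e : Finset (Fin n) // e.card = 2} → Bool

/-- The coloring `c` contains a monochromatic clique of color `b` on `m` vertices. -/
def HasMonoClique {n : ℕ} (c : EdgeColoring n) (b : Bool) (m : ℕ) : Prop :=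
  ∃ S : Finset (Fin n), S.card = m ∧
    ∀ e : {e : Finset (Fin n) // e.card = 2}, (e : Finset (Fin n)) ⊆ S → c e = b

/-- The Ramsey number `R(m, n)`: the least positive integer `N` such that every
red/blue edge coloring of the complete graph on `N` vertices contains a red clique
on `m` vertices or a blue clique on `n` vertices. -/
noncomputable def ramseyNumber (m n : ℕ) : ℕ :=
  sInf {N : ℕ | 0 < N ∧ ∀ c : EdgeColoring N,
    HasMonoClique c true m ∨ HasMonoClique c false n}

/-- A finite set of at least `(m + n).choose n` vertices of a graph contains a clique on
`m` vertices or an independent set on `n` vertices. -/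
theorem SimpleGraph.exists_isNClique_or_isNIndepSet_of_choose_le {V : Type*}
    (G : SimpleGraph V) (m n : ℕ) (s : Finset V) (hs : (m + n).choose n ≤ s.card) :
    (∃ t ⊆ s, G.IsNClique m t) ∨ ∃ t ⊆ s, G.IsNIndepSet n t := by
  classical
  induction m generalizing n s with
  | zero => exact .inl ⟨∅, by simp, by simp [SimpleGraph.isNClique_iff]⟩
  | succ m ihm =>
    induction n generalizing s with
    | zero => exact .inr ⟨∅, by simp, by simp [SimpleGraph.isNIndepSet_iff]⟩
    | succ n ihn =>
      have hpascal : (m + 1 + (n + 1)).choose (n + 1) =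
          (m + 1 + n).choose n + (m + (n + 1)).choose (n + 1) := by
        rw [← add_assoc, Nat.choose_succ_succ, add_right_comm m 1 n, add_assoc m n 1]
      have hpos : 0 < (m + 1 + (n + 1)).choose (n + 1) := Nat.choose_pos (by omega)
      obtain ⟨v, hv⟩ := Finset.card_pos.mp (hpos.trans_le hs)
      have hsplit := Finset.card_filter_add_card_filter_not (s := s.erase v) (G.Adj v)
      have herase := Finset.card_erase_add_one hv
      have hcases : (m + (n + 1)).choose (n + 1) ≤ ((s.erase v).filter (G.Adj v)).card ∨
          (m + 1 + n).choose n ≤ ((s.erase v).filter (¬ G.Adj v ·)).card := by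
        omega
      rcases hcases with h | h
      · rcases ihm (n + 1) _ h with ⟨t, ht, hclique⟩ | ⟨t, ht, hindep⟩
        · refine .inl ⟨insert v t, Finset.insert_subset hv fun x hx => ?_,
            hclique.insert fun x hx => (Finset.mem_filter.mp (ht hx)).2⟩
          exact Finset.mem_of_mem_erase (Finset.mem_filter.mp (ht hx)).1
        · exact .inr ⟨t, ht.trans ((Finset.filter_subset _ _).trans (Finset.erase_subset _ _)),
            hindep⟩
      · rcases ihn _ h with ⟨t, ht, hclique⟩ | ⟨t, ht, hindep⟩
        · exact .inl ⟨t, ht.trans ((Finset.filter_subset _ _).trans (Finset.erase_subset _ _)),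
            hclique⟩
        · refine .inr ⟨insert v t, Finset.insert_subset hv fun x hx => ?_, ?_⟩
          · exact Finset.mem_of_mem_erase (Finset.mem_filter.mp (ht hx)).1
          · rw [← SimpleGraph.isNClique_compl] at hindep ⊢
            refine hindep.insert fun x hx => ?_
            have hx' := Finset.mem_filter.mp (ht hx)
            exact (G.compl_adj v x).mpr ⟨(Finset.ne_of_mem_erase hx'.1).symm, hx'.2⟩

/-- The graph of red edges of an edge coloring. -/
def EdgeColoring.redGraph {N : ℕ} (c : EdgeColoring N) : SimpleGraph (Fin N) where
  Adj a b := ∃ h : ({a, b} : Finset (Fin N)).card = 2, c ⟨{a, b}, h⟩ = true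
  symm := ⟨fun a b h => by simpa only [Finset.pair_comm b a] using h⟩
  loopless := ⟨fun a h => by simp at h⟩

theorem ramsey_le_choose (m n : ℕ) (hm : 1 ≤ m) (hn : 1 ≤ n) :
    ramseyNumber m n ≤ (m + n).choose n := by
  refine Nat.sInf_le ⟨Nat.choose_pos (Nat.le_add_left n m), fun c => ?_⟩
  rcases c.redGraph.exists_isNClique_or_isNIndepSet_of_choose_le m n Finset.univ
    (by simp) with ⟨t, -, ht⟩ | ⟨t, -, ht⟩
  · refine .inl ⟨t, ht.card_eq, ?_⟩
    rintro ⟨e, he⟩ het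
    obtain ⟨a, b, hab, rfl⟩ := Finset.card_eq_two.mp he
    obtain ⟨_, h⟩ := ht.isClique (het (by simp : a ∈ _)) (het (by simp : b ∈ _)) hab
    exact h
  · refine .inr ⟨t, ht.card_eq, ?_⟩
    rintro ⟨e, he⟩ het
    obtain ⟨a, b, hab, rfl⟩ := Finset.card_eq_two.mp he
    have h := ht.isIndepSet (het (by simp : a ∈ _)) (het (by simp : b ∈ _)) hab
    exact Bool.eq_false_iff.mpr fun hc => h ⟨he, hc⟩
end

section
/- E[X²] = 2^(2 − 2·C(k,2)) · (n)_{2k} / (k!)² + 2^(2 − 2·C(k,2)) · (n)_{2k−1} / ((k−1)!)² + Σ_{i=2}^{k} 2^(1 − 2·C(k,2) + C(i,2)) · (n)_{2k−i} / ( i! · ((k−i)!)² ), where (n)_j = n(n−1)⋯(n−j+1) denotes the falling factorial and C(a,2) = a(a−1)/2. -/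
/-- `X`: the number of `k`-element vertex subsets all of whose induced edges
receive the same color (monochromatic `K_k`) in the coloring `c`. -/
def monoCount (n k : ℕ) (c : EdgeColoring n) : ℕ :=
  ((Finset.univ.powersetCard k).filter (fun S : Finset (Fin n) => ∃ b : Bool,
    ∀ e : {e : Finset (Fin n) // e.card = 2}, (e : Finset (Fin n)) ⊆ S → c e = b)).card

/-- Expectation of `f` under the uniform distribution on all edge colorings. -/
noncomputable def expec (n : ℕ) (f : EdgeColoring n → ℝ) : ℝ :=
  (∑ c : EdgeColoring n, f c) / (Fintype.card (EdgeColoring n) : ℝ)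

/-- The `m`-th central moment of the number of monochromatic `K_k`'s in a uniformly
random edge coloring of the complete graph on `n` vertices. -/
noncomputable def centralMoment (n k m : ℕ) : ℝ :=
  expec n (fun c => ((monoCount n k c : ℝ) -
    expec n (fun c' => (monoCount n k c' : ℝ))) ^ m)

open Finset in
/-- The number of functions to `Bool` with prescribed values on a set `A`. -/
theorem card_filter_forall_mem_eq {ι : Type*} [Fintype ι] [DecidableEq ι]
    (A : Finset ι) (g : ι → Bool) :
    ((#{c : ι → Bool | ∀ e ∈ A, c e = g e} : ℕ) : ℝ) =
      (Fintype.card (ι → Bool) : ℝ) * (2 : ℝ) ^ (-(#A : ℤ)) := by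
  have h : ({c : ι → Bool | ∀ e ∈ A, c e = g e} : Finset (ι → Bool)) =
      Fintype.piFinset (fun e => if e ∈ A then {g e} else Finset.univ) := by
    ext c
    simp only [mem_filter, mem_univ, true_and, Fintype.mem_piFinset]
    refine forall_congr' fun e => ?_
    by_cases he : e ∈ A <;> simp [he]
  have hcard : #{c : ι → Bool | ∀ e ∈ A, c e = g e} * 2 ^ #A = Fintype.card (ι → Bool) := by
    have hp : (2 : ℕ) ^ #A = ∏ e : ι, if e ∈ A then 2 else 1 := by
      simp
    rw [h, Fintype.card_piFinset, hp, ← Finset.prod_mul_distrib, Fintype.card_pi]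
    refine Finset.prod_congr rfl fun e _ => ?_
    by_cases he : e ∈ A <;> simp [he]
  rw [← hcard]
  push_cast
  rw [zpow_neg, zpow_natCast, mul_assoc, mul_inv_cancel₀ (by positivity), mul_one]

/-- The edges spanned by a vertex set. -/
def spannedEdges {n : ℕ} (S : Finset (Fin n)) : Finset {e : Finset (Fin n) // e.card = 2} :=
  Finset.univ.filter fun e => (e : Finset (Fin n)) ⊆ S

theorem mem_spannedEdges {n : ℕ} {S : Finset (Fin n)}
    {e : {e : Finset (Fin n) // e.card = 2}} :
    e ∈ spannedEdges S ↔ (e : Finset (Fin n)) ⊆ S := by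
  simp [spannedEdges]

theorem card_spannedEdges {n : ℕ} (S : Finset (Fin n)) :
    (spannedEdges S).card = S.card.choose 2 := by
  rw [← Finset.card_powersetCard, ← Finset.card_map (Function.Embedding.subtype _)]
  congr 1
  ext e
  simp [mem_spannedEdges, Finset.mem_powersetCard, and_comm]

theorem spannedEdges_inter {n : ℕ} (S T : Finset (Fin n)) :
    spannedEdges S ∩ spannedEdges T = spannedEdges (S ∩ T) := by
  ext e
  simp [mem_spannedEdges, Finset.subset_inter_iff]

theorem spannedEdges_nonempty {n : ℕ} {S : Finset (Fin n)} (hS : 2 ≤ S.card) :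
    (spannedEdges S).Nonempty := by
  rw [← Finset.card_pos, card_spannedEdges]
  exact Nat.choose_pos hS

open Finset in
/-- The colorings that are constant on each of two nonempty edge sets, sorted by the two
colors taken. -/
theorem card_filter_constant_on_two {ι : Type*} [Fintype ι] [DecidableEq ι]
    {A B : Finset ι} (hA : A.Nonempty) (hB : B.Nonempty) :
    #{c : ι → Bool | (∃ b, ∀ e ∈ A, c e = b) ∧ ∃ b, ∀ e ∈ B, c e = b} =
      ∑ b : Bool × Bool, #{c : ι → Bool | (∀ e ∈ A, c e = b.1) ∧ ∀ e ∈ B, c e = b.2} := by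
  rw [← Finset.card_biUnion]
  · congr 1
    ext c
    simp only [mem_filter, mem_univ, true_and, mem_biUnion, Prod.exists]
    constructor
    · rintro ⟨⟨b, hb⟩, b', hb'⟩
      exact ⟨b, b', hb, hb'⟩
    · rintro ⟨b, b', hb, hb'⟩
      exact ⟨⟨b, hb⟩, b', hb'⟩
  · rintro ⟨b, b'⟩ - ⟨d, d'⟩ - hne
    refine Finset.disjoint_left.2 fun c hc hd => hne ?_
    simp only [mem_filter, mem_univ, true_and] at hc hd
    obtain ⟨a, ha⟩ := hA
    obtain ⟨a', ha'⟩ := hB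
    exact Prod.ext ((hc.1 a ha).symm.trans (hd.1 a ha))
      ((hc.2 a' ha').symm.trans (hd.2 a' ha'))

open Finset in
theorem card_filter_constant_on_two_of_disjoint {ι : Type*} [Fintype ι] [DecidableEq ι]
    {A B : Finset ι} (hA : A.Nonempty) (hB : B.Nonempty) (hAB : Disjoint A B) :
    ((#{c : ι → Bool | (∃ b, ∀ e ∈ A, c e = b) ∧ ∃ b, ∀ e ∈ B, c e = b} : ℕ) : ℝ) =
      (Fintype.card (ι → Bool) : ℝ) * (2 : ℝ) ^ ((2 : ℤ) - (#A + #B)) := by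
  have key (b b' : Bool) :
      ((#{c : ι → Bool | (∀ e ∈ A, c e = b) ∧ ∀ e ∈ B, c e = b'} : ℕ) : ℝ) =
        (Fintype.card (ι → Bool) : ℝ) * (2 : ℝ) ^ (-((#A : ℤ) + #B)) := by
    have h := card_filter_forall_mem_eq (A ∪ B) (fun e => if e ∈ A then b else b')
    rw [card_union_of_disjoint hAB] at h
    push_cast at h
    rw [← h]
    congr 2
    ext c
    simp only [mem_filter, mem_univ, true_and, mem_union]
    have hd : ∀ e ∈ B, e ∉ A := fun e hB hA => Finset.disjoint_left.1 hAB hA hB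
    grind
  rw [card_filter_constant_on_two hA hB]
  push_cast
  rw [Finset.sum_congr rfl fun b _ => key b.1 b.2, sub_eq_add_neg, zpow_add₀ two_ne_zero]
  simp
  ring

open Finset in
theorem card_filter_constant_on_two_of_inter {ι : Type*} [Fintype ι] [DecidableEq ι]
    {A B : Finset ι} (hAB : (A ∩ B).Nonempty) :
    ((#{c : ι → Bool | (∃ b, ∀ e ∈ A, c e = b) ∧ ∃ b, ∀ e ∈ B, c e = b} : ℕ) : ℝ) =
      (Fintype.card (ι → Bool) : ℝ) * (2 : ℝ) ^ ((1 : ℤ) - (#A + #B) + #(A ∩ B)) := by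
  have hcard : (#(A ∪ B) : ℤ) = #A + #B - #(A ∩ B) := by
    have := card_union_add_card_inter A B
    omega
  have diag (b : Bool) :
      ((#{c : ι → Bool | (∀ e ∈ A, c e = b) ∧ ∀ e ∈ B, c e = b} : ℕ) : ℝ) =
        (Fintype.card (ι → Bool) : ℝ) * (2 : ℝ) ^ (-((#A : ℤ) + #B - #(A ∩ B))) := by
    rw [← hcard, ← card_filter_forall_mem_eq (A ∪ B) (fun _ => b)]
    congr 2
    ext c
    simp only [mem_filter, mem_univ, true_and, mem_union]
    grind
  obtain ⟨a, ha⟩ := hAB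
  rw [mem_inter] at ha
  have off (b b' : Bool) (hb : b ≠ b') :
      #{c : ι → Bool | (∀ e ∈ A, c e = b) ∧ ∀ e ∈ B, c e = b'} = 0 := by
    rw [card_eq_zero, filter_eq_empty_iff]
    rintro c - ⟨h, h'⟩
    exact hb ((h a ha.1).symm.trans (h' a ha.2))
  rw [card_filter_constant_on_two ⟨a, ha.1⟩ ⟨a, ha.2⟩, Fintype.sum_prod_type]
  simp only [Fintype.sum_bool]
  rw [off true false (by simp), off false true (by simp)]
  push_cast
  rw [diag, diag, show (1 : ℤ) - (#A + #B) + #(A ∩ B) = 1 + -((#A : ℤ) + #B - #(A ∩ B)) by ring,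
    zpow_add₀ two_ne_zero, zpow_one]
  ring

open Finset in
/-- The number of `k`-sets meeting a fixed set in exactly `i` elements. -/
theorem card_filter_powersetCard_inter {α : Type*} [Fintype α] [DecidableEq α]
    (S : Finset α) {i k : ℕ} (hik : i ≤ k) :
    #{T ∈ powersetCard k (univ : Finset α) | #(S ∩ T) = i} =
      (#S).choose i * (Fintype.card α - #S).choose (k - i) := by
  rw [← card_compl, ← card_powersetCard i S, ← card_powersetCard (k - i) Sᶜ, ← card_product]
  refine card_nbij' (fun T => (S ∩ T, Sᶜ ∩ T)) (fun P => P.1 ∪ P.2) ?_ ?_ ?_ ?_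
  · intro T hT
    simp only [coe_filter, Set.mem_ofPred_eq, mem_powersetCard, subset_univ, true_and] at hT
    have h := card_inter_add_card_sdiff T S
    rw [inter_comm, sdiff_eq_inter_compl, inter_comm T] at h
    simp only [coe_product, Set.mem_prod, mem_coe, mem_powersetCard, inter_subset_left, true_and]
    omega
  · rintro ⟨P, Q⟩ h
    simp only [coe_product, Set.mem_prod, mem_coe, mem_powersetCard] at h
    obtain ⟨⟨hP, hPc⟩, hQ, hQc⟩ := h
    have hd : Disjoint P Q := Disjoint.mono hP hQ (_root_.disjoint_compl_right (a := S))
    have hi : S ∩ (P ∪ Q) = P := by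
      ext x
      have h1 := @hP x
      have h2 := @hQ x
      simp only [mem_compl] at h2
      simp only [mem_inter, mem_union]
      tauto
    simp only [coe_filter, Set.mem_ofPred_eq, mem_powersetCard, subset_univ, true_and, hi,
      card_union_of_disjoint hd]
    omega
  · intro T _
    ext x
    simp only [mem_union, mem_inter, mem_compl]
    tauto
  · rintro ⟨P, Q⟩ h
    simp only [coe_product, Set.mem_prod, mem_coe, mem_powersetCard] at h
    obtain ⟨⟨hP, -⟩, hQ, -⟩ := h
    refine Prod.ext ?_ ?_ <;>
    · ext x
      have h1 := @hP x
      have h2 := @hQ x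
      simp only [mem_compl] at h2
      simp only [mem_inter, mem_union, mem_compl]
      tauto

theorem choose_mul_choose_mul_choose_eq {n k i : ℕ} (hik : i ≤ k) :
    ((n.choose k * (k.choose i * (n - k).choose (k - i)) : ℕ) : ℝ) =
      (n.descFactorial (2 * k - i) : ℝ) / ((i.factorial : ℝ) * ((k - i).factorial : ℝ) ^ 2) := by
  rw [eq_div_iff (by positivity)]
  norm_cast
  rw [← Nat.descFactorial_mul_descFactorial (n := n) (k := k) (m := 2 * k - i) (by omega),
    show 2 * k - i - k = k - i by omega, Nat.descFactorial_eq_factorial_mul_choose,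
    Nat.descFactorial_eq_factorial_mul_choose, ← Nat.choose_mul_factorial_mul_factorial hik]
  ring

open Finset in
/-- Summing a function of `#(S ∩ T)` over pairs of `k`-sets. -/
theorem sum_powersetCard_card_inter (n k : ℕ) (f : ℕ → ℝ) :
    ∑ S ∈ powersetCard k (univ : Finset (Fin n)), ∑ T ∈ powersetCard k (univ : Finset (Fin n)),
        f #(S ∩ T) =
      ∑ i ∈ range (k + 1), f i * ((n.descFactorial (2 * k - i) : ℝ) /
        ((i.factorial : ℝ) * ((k - i).factorial : ℝ) ^ 2)) := by
  have inner (S : Finset (Fin n)) (hS : S ∈ powersetCard k (univ : Finset (Fin n))) :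
      ∑ T ∈ powersetCard k (univ : Finset (Fin n)), f #(S ∩ T) =
        ∑ i ∈ range (k + 1), ((k.choose i * (n - k).choose (k - i) : ℕ) : ℝ) * f i := by
    rw [mem_powersetCard] at hS
    rw [← sum_fiberwise_of_maps_to (t := range (k + 1)) (g := fun T => #(S ∩ T))]
    · refine sum_congr rfl fun i hi => ?_
      have h := card_filter_powersetCard_inter S (Nat.lt_succ_iff.1 (mem_range.1 hi))
      rw [hS.2, Fintype.card_fin] at h
      rw [sum_congr rfl fun T hT => by rw [(mem_filter.1 hT).2], sum_const, h, nsmul_eq_mul]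
    · intro T _
      have := card_le_card (inter_subset_left (s₁ := S) (s₂ := T))
      rw [mem_range]
      omega
  rw [sum_congr rfl inner, sum_const, card_powersetCard, card_univ, Fintype.card_fin,
    nsmul_eq_mul, mul_sum]
  refine sum_congr rfl fun i hi => ?_
  rw [← choose_mul_choose_mul_choose_eq (Nat.lt_succ_iff.1 (mem_range.1 hi))]
  push_cast
  ring

open Finset in
theorem sum_monoCount_sq (n k : ℕ) :
    ∑ c : EdgeColoring n, (monoCount n k c : ℝ) ^ 2 =
      ∑ S ∈ powersetCard k (univ : Finset (Fin n)), ∑ T ∈ powersetCard k (univ : Finset (Fin n)),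
        ((#{c : EdgeColoring n | (∃ b, ∀ e ∈ spannedEdges S, c e = b) ∧
          ∃ b, ∀ e ∈ spannedEdges T, c e = b} : ℕ) : ℝ) := by
  have h (c : EdgeColoring n) : (monoCount n k c : ℝ) =
      ∑ S ∈ powersetCard k (univ : Finset (Fin n)),
        if ∃ b, ∀ e ∈ spannedEdges S, c e = b then (1 : ℝ) else 0 := by
    rw [sum_boole]
    simp only [monoCount, mem_spannedEdges]
  simp only [h, sq, sum_mul_sum]
  rw [sum_comm]
  refine sum_congr rfl fun S _ => ?_
  rw [sum_comm]
  refine sum_congr rfl fun T _ => ?_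
  rw [← sum_boole]
  refine sum_congr rfl fun c _ => ?_
  rw [ite_zero_mul_ite_zero, one_mul]

theorem second_moment (n k : ℕ) (hk : 2 ≤ k) (hn : k ≤ n) :
    expec n (fun c => (monoCount n k c : ℝ) ^ 2) =
      (2 : ℝ) ^ ((2 : ℤ) - 2 * (k.choose 2 : ℤ)) * (n.descFactorial (2 * k) : ℝ) /
        (k.factorial : ℝ) ^ 2
      + (2 : ℝ) ^ ((2 : ℤ) - 2 * (k.choose 2 : ℤ)) * (n.descFactorial (2 * k - 1) : ℝ) /
        ((k - 1).factorial : ℝ) ^ 2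
      + ∑ i ∈ Finset.Icc 2 k,
          (2 : ℝ) ^ ((1 : ℤ) - 2 * (k.choose 2 : ℤ) + (i.choose 2 : ℤ)) *
            (n.descFactorial (2 * k - i) : ℝ) /
            ((i.factorial : ℝ) * ((k - i).factorial : ℝ) ^ 2) := by
  set w : ℕ → ℝ := fun i => if i < 2 then (2 : ℝ) ^ ((2 : ℤ) - 2 * (k.choose 2 : ℤ))
    else (2 : ℝ) ^ ((1 : ℤ) - 2 * (k.choose 2 : ℤ) + (i.choose 2 : ℤ)) with hw
  have hpair : ∀ S ∈ Finset.powersetCard k (Finset.univ : Finset (Fin n)),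
      ∀ T ∈ Finset.powersetCard k (Finset.univ : Finset (Fin n)),
      (((Finset.univ.filter fun c : EdgeColoring n =>
        (∃ b, ∀ e ∈ spannedEdges S, c e = b) ∧
          ∃ b, ∀ e ∈ spannedEdges T, c e = b).card : ℕ) : ℝ) =
        (Fintype.card (EdgeColoring n) : ℝ) * w (S ∩ T).card := by
    intro S hS T hT
    rw [Finset.mem_powersetCard] at hS hT
    by_cases hi : (S ∩ T).card < 2
    · have hd : Disjoint (spannedEdges S) (spannedEdges T) := by
        rw [Finset.disjoint_iff_inter_eq_empty, spannedEdges_inter, ← Finset.card_eq_zero,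
          card_spannedEdges, Nat.choose_eq_zero_of_lt hi]
      rw [card_filter_constant_on_two_of_disjoint (spannedEdges_nonempty (by omega))
        (spannedEdges_nonempty (by omega)) hd, card_spannedEdges, card_spannedEdges, hS.2, hT.2]
      simp only [hw, if_pos hi, two_mul]
    · rw [card_filter_constant_on_two_of_inter
          (by rw [spannedEdges_inter]; exact spannedEdges_nonempty (by omega)),
        spannedEdges_inter, card_spannedEdges, card_spannedEdges, card_spannedEdges, hS.2, hT.2]
      simp only [hw, if_neg hi, two_mul]
  have hN : (Fintype.card (EdgeColoring n) : ℝ) ≠ 0 := by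
    exact_mod_cast Fintype.card_ne_zero
  rw [expec, sum_monoCount_sq, Finset.sum_congr rfl fun S hS => Finset.sum_congr rfl (hpair S hS)]
  simp only [← Finset.mul_sum]
  rw [mul_div_cancel_left₀ _ hN, sum_powersetCard_card_inter n k w, Finset.range_eq_Ico,
    Finset.sum_eq_sum_Ico_succ_bot (by omega), Finset.sum_eq_sum_Ico_succ_bot (by omega),
    ← add_assoc]
  refine congrArg₂ _ (congrArg₂ _ ?_ ?_) (Finset.sum_congr ?_ fun i hi => ?_)
  · simp [hw, mul_div_assoc]
  · simp [hw, mul_div_assoc]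
  · ext i
    simp
  · have hi2 : ¬ i < 2 := by
      have := (Finset.mem_Icc.1 hi).1
      omega
    simp only [hw, if_neg hi2, mul_div_assoc]
end

section
/- Fix an integer k ≥ 3 and let μ = E[X]. As n → ∞, the variance E[(X − μ)²] is asymptotically equivalent to (1/2) · (1/((k−3)!)²) · n^(2k−3) / 2^(2·C(k,2) − 2), i.e., the ratio of the two quantities tends to 1. -/
open Finset

/-- The edges inside the vertex set `S`. -/
def edgesIn {n : ℕ} (S : Finset (Fin n)) : Finset {e : Finset (Fin n) // e.card = 2} :=
  univ.filter fun e => (e : Finset (Fin n)) ⊆ S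

lemma card_edgesIn {n : ℕ} (S : Finset (Fin n)) : (edgesIn S).card = S.card.choose 2 := by
  rw [← card_powersetCard, ← card_map (Function.Embedding.subtype _)]
  congr 1
  ext e
  simp [edgesIn, mem_powersetCard, and_comm]

lemma edgesIn_inter {n : ℕ} (S T : Finset (Fin n)) :
    edgesIn S ∩ edgesIn T = edgesIn (S ∩ T) := by
  ext e
  simp [edgesIn, subset_inter_iff]

lemma card_filter_eqOn {α : Type*} [Fintype α] [DecidableEq α] (D : Finset α) (g : α → Bool) :
    (univ.filter fun c : α → Bool => ∀ e ∈ D, c e = g e).card * 2 ^ D.card =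
      2 ^ Fintype.card α := by
  have h : (univ.filter fun c : α → Bool => ∀ e ∈ D, c e = g e) =
      Fintype.piFinset fun e => if e ∈ D then {g e} else univ := by
    ext c
    simp only [mem_filter, mem_univ, true_and, Fintype.mem_piFinset]
    refine forall_congr' fun e => ?_
    split_ifs with he <;> simp [he]
  have hcard : ∀ e, (if e ∈ D then {g e} else univ : Finset Bool).card =
      if e ∈ D then 1 else 2 := fun e => by split_ifs <;> simp
  rw [h, Fintype.card_piFinset]
  simp only [hcard, prod_ite, prod_const, one_pow, one_mul]
  rw [filter_not, filter_mem_eq_inter, univ_inter, ← compl_eq_univ_sdiff, ← pow_add, add_comm,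
    card_add_card_compl]

lemma expec_eqOn {n : ℕ} (D : Finset {e : Finset (Fin n) // e.card = 2})
    (g : {e : Finset (Fin n) // e.card = 2} → Bool) :
    expec n (fun c => if ∀ e ∈ D, c e = g e then 1 else 0) = (1 / 2) ^ D.card := by
  have h := congrArg (Nat.cast (R := ℝ)) (card_filter_eqOn D g)
  push_cast at h
  rw [expec, sum_boole, Fintype.card_fun, Fintype.card_bool, one_div, inv_pow]
  push_cast
  rw [← h]
  have h' : (#{c : EdgeColoring n | ∀ e ∈ D, c e = g e} : ℝ) ≠ 0 := by
    intro h0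
    rw [h0] at h
    simp at h
    exact absurd h.symm (by positivity)
  field_simp

lemma expec_sum {n : ℕ} {ι : Type*} (s : Finset ι) (f : ι → EdgeColoring n → ℝ) :
    expec n (fun c => ∑ i ∈ s, f i c) = ∑ i ∈ s, expec n (f i) := by
  simp only [expec]
  rw [sum_comm, sum_div]

lemma expec_sub_expec_sq (n : ℕ) (f : EdgeColoring n → ℝ) :
    expec n (fun c => (f c - expec n f) ^ 2) = expec n (fun c => f c * f c) -
      expec n f * expec n f := by
  have h : (Fintype.card (EdgeColoring n) : ℝ) ≠ 0 := by positivity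
  have h1 : ∑ c, f c = expec n f * Fintype.card (EdgeColoring n) := by
    rw [expec, div_mul_cancel₀ _ h]
  set m := expec n f
  simp only [expec, sub_sq, sum_add_distrib, sum_sub_distrib, ← sum_mul, ← mul_sum, h1,
    sum_const, card_univ, nsmul_eq_mul]
  simp only [← pow_two]
  field_simp
  ring

/-- The indicator that all edges in `D` have color `b`. -/
def colorIndicator {n : ℕ} (D : Finset {e : Finset (Fin n) // e.card = 2}) (b : Bool)
    (c : EdgeColoring n) : ℝ :=
  if ∀ e ∈ D, c e = b then 1 else 0

/-- The indicator that `D` is monochromatic, provided `D` is nonempty. -/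
def monoIndicator {n : ℕ} (D : Finset {e : Finset (Fin n) // e.card = 2})
    (c : EdgeColoring n) : ℝ :=
  ∑ b, colorIndicator D b c

lemma expec_monoIndicator {n : ℕ} (D : Finset {e : Finset (Fin n) // e.card = 2}) :
    expec n (monoIndicator D) = 2 * (1 / 2) ^ D.card := by
  have h (b : Bool) : expec n (colorIndicator D b) = (1 / 2) ^ D.card :=
    expec_eqOn D fun _ => b
  change expec n (fun c => ∑ b, colorIndicator D b c) = _
  rw [expec_sum]
  simp [h]

lemma monoIndicator_eq {n : ℕ} {D : Finset {e : Finset (Fin n) // e.card = 2}}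
    (hD : D.Nonempty) (c : EdgeColoring n) :
    monoIndicator D c = if ∃ b, ∀ e ∈ D, c e = b then 1 else 0 := by
  obtain ⟨e, he⟩ := hD
  have h (b : Bool) (hb : b ≠ c e) : ¬ ∀ e ∈ D, c e = b := fun h => hb (h e he).symm
  simp only [monoIndicator, colorIndicator]
  rw [sum_eq_single (c e) (fun b _ hb => if_neg (h b hb)) (by simp)]
  refine if_congr ⟨fun h => ⟨_, h⟩, ?_⟩ rfl rfl
  rintro ⟨b, hb⟩
  rwa [hb e he]

lemma expec_colorIndicator_mul_self {n : ℕ} (A B : Finset {e : Finset (Fin n) // e.card = 2})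
    (b : Bool) :
    expec n (fun c => colorIndicator A b c * colorIndicator B b c) =
      (1 / 2) ^ (A ∪ B).card := by
  rw [← expec_eqOn (A ∪ B) fun _ => b]
  congr 1
  ext c
  simp only [colorIndicator, ite_mul, one_mul, zero_mul, ← ite_and, forall_mem_union]

lemma expec_colorIndicator_mul_of_ne {n : ℕ}
    (A B : Finset {e : Finset (Fin n) // e.card = 2}) {b b' : Bool} (hb : b ≠ b') :
    expec n (fun c => colorIndicator A b c * colorIndicator B b' c) =
      if Disjoint A B then (1 / 2) ^ (A ∪ B).card else 0 := by
  split_ifs with h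
  · rw [← expec_eqOn (A ∪ B) fun e => if e ∈ A then b else b']
    congr 1
    ext c
    simp only [colorIndicator, ite_mul, one_mul, zero_mul, ← ite_and, forall_mem_union]
    refine if_congr (and_congr ?_ ?_) rfl rfl
    · exact forall₂_congr fun e he => by rw [if_pos he]
    · exact forall₂_congr fun e he => by rw [if_neg (disjoint_right.1 h he)]
  · obtain ⟨e, hA, hB⟩ := not_disjoint_iff.1 h
    have h0 (c : EdgeColoring n) : colorIndicator A b c * colorIndicator B b' c = 0 := by
      simp only [colorIndicator, ite_mul, one_mul, zero_mul, ← ite_and]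
      exact if_neg fun hc => hb ((hc.1 e hA).symm.trans (hc.2 e hB))
    simp [h0, expec]

lemma expec_monoIndicator_mul {n : ℕ} (A B : Finset {e : Finset (Fin n) // e.card = 2}) :
    expec n (fun c => monoIndicator A c * monoIndicator B c) =
      (if Disjoint A B then 4 else 2) * (1 / 2) ^ (A ∪ B).card := by
  simp only [monoIndicator, sum_mul_sum, expec_sum]
  simp only [Fintype.sum_bool, expec_colorIndicator_mul_self,
    expec_colorIndicator_mul_of_ne A B Bool.false_ne_true,
    expec_colorIndicator_mul_of_ne A B Bool.false_ne_true.symm]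
  split_ifs <;> ring

/-- The covariance of the monochromaticity of two `k`-sets with `j` common vertices. -/
noncomputable def overlapCov (k j : ℕ) : ℝ :=
  if j < 2 then 0 else (2 * 2 ^ j.choose 2 - 4) / 2 ^ (2 * k.choose 2)

lemma expec_monoIndicator_mul_sub {n k : ℕ} {S T : Finset (Fin n)} (hS : S.card = k)
    (hT : T.card = k) :
    expec n (fun c => monoIndicator (edgesIn S) c * monoIndicator (edgesIn T) c) -
      expec n (monoIndicator (edgesIn S)) * expec n (monoIndicator (edgesIn T)) =
        overlapCov k (S ∩ T).card := by
  have hu := card_union_add_card_inter (edgesIn S) (edgesIn T)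
  have hd : Disjoint (edgesIn S) (edgesIn T) ↔ (S ∩ T).card < 2 := by
    rw [disjoint_iff_inter_eq_empty, edgesIn_inter, ← card_eq_zero, card_edgesIn,
      Nat.choose_eq_zero_iff]
  rw [edgesIn_inter, card_edgesIn, card_edgesIn, card_edgesIn, hS, hT] at hu
  have hp : (2 : ℝ) ^ (edgesIn S ∪ edgesIn T).card * 2 ^ (S ∩ T).card.choose 2 =
      2 ^ (2 * k.choose 2) := by
    rw [← pow_add, hu, two_mul]
  rw [expec_monoIndicator_mul, expec_monoIndicator, expec_monoIndicator, card_edgesIn,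
    card_edgesIn, hS, hT, overlapCov, ← hp]
  have hq : (2 : ℝ) ^ k.choose 2 * 2 ^ k.choose 2 =
      2 ^ (edgesIn S ∪ edgesIn T).card * 2 ^ (S ∩ T).card.choose 2 := by
    rw [hp, two_mul, pow_add]
  have hr : (2 * (1 / 2) ^ k.choose 2 * (2 * (1 / 2) ^ k.choose 2) : ℝ) =
      4 / (2 ^ (edgesIn S ∪ edgesIn T).card * 2 ^ (S ∩ T).card.choose 2) := by
    rw [← hq, one_div, inv_pow]
    field_simp
    norm_num
  rw [hr, one_div, inv_pow]
  simp only [hd]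
  split_ifs with h
  · rw [Nat.choose_eq_zero_of_lt h]
    field_simp
    ring
  · field_simp

lemma card_filter_card_inter {α : Type*} [Fintype α] [DecidableEq α] (S : Finset α) {j k : ℕ}
    (hj : j ≤ k) :
    ((univ.powersetCard k).filter fun T => (S ∩ T).card = j).card =
      S.card.choose j * (Fintype.card α - S.card).choose (k - j) := by
  rw [← card_compl, ← card_powersetCard, ← card_powersetCard, ← card_product]
  refine card_bij' (fun T _ => (S ∩ T, Sᶜ ∩ T)) (fun P _ => P.1 ∪ P.2) ?_ ?_ ?_ ?_
  · intro T hT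
    simp only [mem_filter, mem_powersetCard, subset_univ, true_and] at hT
    have h : (S ∩ T).card + (Sᶜ ∩ T).card = T.card := by
      rw [inter_comm, inter_comm Sᶜ, ← sdiff_eq_inter_compl, card_inter_add_card_sdiff]
    simp only [mem_product, mem_powersetCard, inter_subset_left, true_and]
    omega
  · rintro ⟨P, Q⟩ h
    simp only [mem_product, mem_powersetCard] at h
    obtain ⟨⟨hP, rfl⟩, hQ, hQc⟩ := h
    have hd : Disjoint S Q := (disjoint_compl_right (a := S)).mono_right hQ
    simp only [mem_filter, mem_powersetCard, subset_univ, true_and]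
    rw [card_union_of_disjoint (hd.mono_left hP), inter_union_distrib_left,
      inter_eq_right.2 hP, disjoint_iff_inter_eq_empty.1 hd, union_empty]
    omega
  · intro T _
    simp [← union_inter_distrib_right]
  · rintro ⟨P, Q⟩ h
    simp only [mem_product, mem_powersetCard] at h
    have hd : Disjoint S Q := (disjoint_compl_right (a := S)).mono_right h.2.1
    have hd' : Disjoint Sᶜ P := (disjoint_compl_left (a := S)).mono_right h.1.1
    simp only [inter_union_distrib_left, inter_eq_right.2 h.1.1, inter_eq_right.2 h.2.1,
      disjoint_iff_inter_eq_empty.1 hd, disjoint_iff_inter_eq_empty.1 hd', union_empty,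
      empty_union]

lemma cast_monoCount {n k : ℕ} (hk : 2 ≤ k) (c : EdgeColoring n) :
    (monoCount n k c : ℝ) = ∑ S ∈ univ.powersetCard k, monoIndicator (edgesIn S) c := by
  rw [monoCount, ← sum_boole]
  refine sum_congr rfl fun S hS => ?_
  have h : (edgesIn S).Nonempty := by
    rw [← card_pos, card_edgesIn, (mem_powersetCard.1 hS).2]
    exact Nat.choose_pos hk
  rw [monoIndicator_eq h]
  simp [edgesIn]

theorem centralMoment_two (n : ℕ) {k : ℕ} (hk : 2 ≤ k) :
    centralMoment n k 2 = n.choose k *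
      ∑ j ∈ range (k + 1), (k.choose j * (n - k).choose (k - j) : ℕ) * overlapCov k j := by
  have hS : ∀ S ∈ (univ : Finset (Fin n)).powersetCard k,
      ∑ T ∈ univ.powersetCard k, overlapCov k (S ∩ T).card =
        ∑ j ∈ range (k + 1), (k.choose j * (n - k).choose (k - j) : ℕ) * overlapCov k j := by
    intro S hS
    rw [mem_powersetCard] at hS
    rw [← sum_fiberwise_of_maps_to (t := range (k + 1)) (g := fun T => (S ∩ T).card)]
    · refine sum_congr rfl fun j hj => ?_
      rw [sum_congr rfl fun T hT => by rw [(mem_filter.1 hT).2], sum_const, nsmul_eq_mul,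
        card_filter_card_inter S (Nat.lt_succ_iff.1 (mem_range.1 hj)), hS.2, Fintype.card_fin]
    · intro T _
      exact mem_range.2 (Nat.lt_succ_of_le (hS.2 ▸ card_le_card inter_subset_left))
  rw [centralMoment, expec_sub_expec_sq n fun c => (monoCount n k c : ℝ)]
  simp only [cast_monoCount hk, sum_mul_sum, expec_sum, ← sum_sub_distrib]
  rw [sum_congr rfl fun S hS => sum_congr rfl fun T hT =>
    expec_monoIndicator_mul_sub (mem_powersetCard.1 hS).2 (mem_powersetCard.1 hT).2,
    sum_congr rfl hS, sum_const, card_powersetCard, card_univ, Fintype.card_fin, nsmul_eq_mul]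

open Filter Topology in
lemma tendsto_choose_div_pow (m : ℕ) :
    Tendsto (fun n : ℕ => (n.choose m : ℝ) / (n : ℝ) ^ m) atTop (𝓝 (1 / (m.factorial : ℝ))) := by
  have h := (Asymptotics.isEquivalent_iff_tendsto_one ?_).1 (isEquivalent_choose m)
  · have h' := h.div_const (m.factorial : ℝ)
    refine h'.congr fun n => ?_
    have hm : (m.factorial : ℝ) ≠ 0 := by positivity
    simp only [Pi.div_apply]
    field_simp
  · filter_upwards [eventually_gt_atTop 0] with n hn
    positivity

open Filter Topology in
lemma tendsto_choose_sub_div_pow (k m : ℕ) :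
    Tendsto (fun n : ℕ => ((n - k).choose m : ℝ) / (n : ℝ) ^ m) atTop
      (𝓝 (1 / (m.factorial : ℝ))) := by
  have h1 := (tendsto_choose_div_pow m).comp (tendsto_sub_atTop_nat k)
  have h2 : Tendsto (fun n : ℕ => (1 - (k : ℝ) / n) ^ m) atTop (𝓝 1) := by
    simpa using ((tendsto_const_div_atTop_nhds_zero_nat (k : ℝ)).const_sub 1).pow m
  have h3 := h1.mul h2
  rw [mul_one] at h3
  refine h3.congr' ?_
  filter_upwards [eventually_gt_atTop k] with n hn
  have hn0 : (n : ℝ) ≠ 0 := Nat.cast_ne_zero.2 (by omega)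
  have hnk : ((n - k : ℕ) : ℝ) ≠ 0 := Nat.cast_ne_zero.2 (by omega)
  have hs : 1 - (k : ℝ) / n = ((n - k : ℕ) : ℝ) / n := by
    rw [Nat.cast_sub hn.le]
    field_simp
  simp only [Function.comp_apply]
  rw [hs, div_pow]
  field_simp

lemma overlapCov_eq_zero (k : ℕ) {j : ℕ} (hj : j < 3) : overlapCov k j = 0 := by
  interval_cases j <;> norm_num [overlapCov]

lemma overlapCov_three (k : ℕ) : overlapCov k 3 = 12 / 2 ^ (2 * k.choose 2) := by
  norm_num [overlapCov, Nat.choose]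

open Filter Topology in
lemma tendsto_overlap_term {k j : ℕ} (hj : j ≤ k) :
    Tendsto (fun n : ℕ => (n.choose k : ℝ) *
        ((k.choose j * (n - k).choose (k - j) : ℕ) * overlapCov k j) / (n : ℝ) ^ (2 * k - 3))
      atTop (𝓝 (if j = 3 then
        1 / k.factorial * (k.choose 3 * (1 / (k - 3).factorial) * overlapCov k 3) else 0)) := by
  rcases lt_or_ge j 3 with h | h
  · simp [overlapCov_eq_zero k h, h.ne]
  have hinv : Tendsto (fun n : ℕ => (1 / (n : ℝ)) ^ (j - 3)) atTop
      (𝓝 (if j = 3 then 1 else 0)) := by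
    split_ifs with h3
    · simp [h3]
    · simpa [show j - 3 ≠ 0 by omega] using
        (tendsto_one_div_atTop_nhds_zero_nat (𝕜 := ℝ)).pow (j - 3)
  have hlim := ((tendsto_choose_div_pow k).mul
    (((tendsto_choose_sub_div_pow k (k - j)).const_mul (k.choose j : ℝ)).mul_const
      (overlapCov k j))).mul hinv
  have hval : (1 / (k.factorial : ℝ) * ((k.choose j : ℝ) * (1 / ((k - j).factorial : ℝ)) *
      overlapCov k j) * if j = 3 then 1 else 0) = if j = 3 then
        1 / k.factorial * (k.choose 3 * (1 / (k - 3).factorial) * overlapCov k 3) else 0 := by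
    split_ifs with h3
    · rw [h3, mul_one]
    · rw [mul_zero]
  rw [hval] at hlim
  refine hlim.congr' ?_
  filter_upwards [eventually_gt_atTop 0] with n hn
  have hn0 : (n : ℝ) ≠ 0 := Nat.cast_ne_zero.2 hn.ne'
  have hpow : (n : ℝ) ^ (2 * k - 3) = n ^ k * n ^ (k - j) * n ^ (j - 3) := by
    rw [← pow_add, ← pow_add]
    congr 1
    omega
  rw [hpow, one_div, inv_pow]
  push_cast
  field_simp

theorem variance_asymptotic (k : ℕ) (hk : 3 ≤ k) :
    Filter.Tendsto (fun n : ℕ =>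
      centralMoment n k 2 /
        ((1 / 2) * (1 / ((k - 3).factorial : ℝ) ^ 2) * (n : ℝ) ^ (2 * k - 3) /
          (2 : ℝ) ^ (2 * k.choose 2 - 2)))
      Filter.atTop (nhds 1) := by
  have hlim := (tendsto_finsetSum (range (k + 1)) fun j hj =>
    tendsto_overlap_term (Nat.lt_succ_iff.1 (mem_range.1 hj))).div_const
      ((1 / 2) * (1 / ((k - 3).factorial : ℝ) ^ 2) / (2 : ℝ) ^ (2 * k.choose 2 - 2))
  have hfac : (k.choose 3 * 6 * (k - 3).factorial : ℝ) = k.factorial := by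
    exact_mod_cast Nat.choose_mul_factorial_mul_factorial hk
  have hc : 3 ≤ k.choose 2 := Nat.choose_le_choose 2 hk
  have hp : (2 : ℝ) ^ (2 * k.choose 2) = 2 ^ (2 * k.choose 2 - 2) * 4 := by
    rw [show (4 : ℝ) = 2 ^ 2 by norm_num, ← pow_add]
    congr 1
    omega
  rw [sum_ite_eq' (range (k + 1)) 3, if_pos (mem_range.2 (by omega)), overlapCov_three, hp,
    ← hfac] at hlim
  have hch : (k.choose 3 : ℝ) ≠ 0 := Nat.cast_ne_zero.2 (Nat.choose_pos hk).ne'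
  have hone : 1 / (k.choose 3 * 6 * (k - 3).factorial : ℝ) *
      (k.choose 3 * (1 / (k - 3).factorial) * (12 / (2 ^ (2 * k.choose 2 - 2) * 4))) /
      ((1 / 2) * (1 / ((k - 3).factorial : ℝ) ^ 2) / (2 : ℝ) ^ (2 * k.choose 2 - 2)) = 1 := by
    field_simp
    norm_num
  rw [hone] at hlim
  refine hlim.congr fun n => ?_
  rw [← sum_div, ← mul_sum, ← centralMoment_two n (by omega : 2 ≤ k), div_div]
  congr 1
  ring
end
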